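/- Let 0 ≤ k < N. For every triple (n₊, n₀, n₋) of non-negative integers with n₊ ≥ k, n₋ ≥ 1, and n₊ + n₀ + n₋ = N, there exists an N×N Hermitian matrix with exactly n₊ positive, n₀ zero, and n₋ negative eigenvalues which is k-PMP but not (k+1)-PMP. -/

import Mathlib

open Matrix
open scoped ComplexOrder

/-- A Hermitian matrix is `k`-PMP if all its principal minors of size at most `k`
are non-negative. -/
def kPMP {N : ℕ} (k : ℕ) (A : Matrix (Fin N) (Fin N) ℂ) : Prop :=
  ∀ S : Finset (Fin N), S.card ≤ k →
    0 ≤ (A.submatrix (fun i : S => (i : Fin N)) (fun i : S => (i : Fin N))).det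

/-- rectangular Vandermonde matrix -/
noncomputable def vanW {ι : Type} (v : ι → ℂ) (k : ℕ) : Matrix ι (Fin k) ℂ :=
  Matrix.of fun i j => v i ^ (j : ℕ)

theorem vanW_rank {ι : Type} [Fintype ι] (v : ι → ℂ) (hv : Function.Injective v) (k : ℕ) :
    (vanW v k).rank = min (Fintype.card ι) k := by
  classical
  apply le_antisymm
  · refine le_min (Matrix.rank_le_card_height _) ?_
    simpa using Matrix.rank_le_card_width (vanW v k)
  · set r := min (Fintype.card ι) k with hr
    have h1 : r ≤ Fintype.card ι := min_le_left _ _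
    have h2 : r ≤ k := min_le_right _ _
    let f : Fin r → ι := fun i => (Fintype.equivFin ι).symm (Fin.castLE h1 i)
    have hf : Function.Injective f :=
      (Fintype.equivFin ι).symm.injective.comp (Fin.castLE_injective h1)
    have hle := Matrix.rank_submatrix_le (vanW v k) f (Fin.castLE h2)
    have heq : (vanW v k).submatrix f (Fin.castLE h2) = Matrix.vandermonde (v ∘ f) := by
      ext i j
      simp [vanW, Matrix.vandermonde_apply]
    rw [heq] at hle
    have hdet : (Matrix.vandermonde (v ∘ f)).det ≠ 0 :=
      Matrix.det_vandermonde_ne_zero_iff.mpr (hv.comp hf)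
    have hu : IsUnit (Matrix.vandermonde (v ∘ f)) := by
      rw [Matrix.isUnit_iff_isUnit_det]
      exact hdet.isUnit
    rw [Matrix.rank_of_isUnit _ hu] at hle
    simpa using hle

/-- shifted Gram matrix -/
noncomputable def gramW {ι : Type} [DecidableEq ι] (v : ι → ℂ) (k : ℕ) (ε : ℝ) :
    Matrix ι ι ℂ := vanW v k * (vanW v k)ᴴ - Matrix.diagonal (fun _ => (ε : ℂ))

theorem gramW_submatrix {ι σ : Type} [DecidableEq ι] [DecidableEq σ] (v : ι → ℂ) (k : ℕ) (ε : ℝ)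
    (f : σ → ι) (hf : Function.Injective f) :
    (gramW v k ε).submatrix f f = gramW (v ∘ f) k ε := by
  ext i j
  simp [gramW, vanW, Matrix.mul_apply, Matrix.diagonal_apply, hf.eq_iff]

theorem gramW_herm {ι : Type} [DecidableEq ι] (v : ι → ℂ) (k : ℕ) (ε : ℝ) :
    (gramW v k ε).IsHermitian := by
  refine (Matrix.isHermitian_mul_conjTranspose_self _).sub ?_
  rw [Matrix.isHermitian_diagonal_iff]
  intro i
  simp [IsSelfAdjoint]

open Polynomial Filter Topology in
theorem gramW_core {ι : Type} [Fintype ι] [DecidableEq ι] (v : ι → ℂ)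
    (hv : Function.Injective v) (k : ℕ) :
    ∀ᶠ ε in 𝓝[>] (0 : ℝ), ∃ μ : ι → ℝ,
      (gramW v k ε).charpoly = ∏ i, (X - C (μ i : ℂ)) ∧
      (gramW v k ε).det = ((∏ i, μ i : ℝ) : ℂ) ∧
      (Finset.univ.filter fun i => 0 < μ i).card = min (Fintype.card ι) k ∧
      ∀ i, μ i ≠ 0 := by
  have hps : (vanW v k * (vanW v k)ᴴ).PosSemidef := Matrix.posSemidef_self_mul_conjTranspose _
  have hH := hps.isHermitian
  have hrank := hH.rank_eq_card_non_zero_eigs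
  rw [Matrix.rank_self_mul_conjTranspose, vanW_rank v hv, Fintype.card_subtype] at hrank
  have hnn := hps.eigenvalues_nonneg
  have hsmall : ∀ᶠ ε in 𝓝[>] (0 : ℝ), ∀ i, hH.eigenvalues i ≠ 0 → ε < hH.eigenvalues i := by
    rw [eventually_all]
    intro i
    by_cases h : hH.eigenvalues i = 0
    · simp [h]
    · have : 0 < hH.eigenvalues i := lt_of_le_of_ne (hnn i) (Ne.symm h)
      filter_upwards [nhdsWithin_le_nhds (eventually_lt_nhds this)] with ε hε _ using hε
  filter_upwards [hsmall, self_mem_nhdsWithin] with ε hε hpos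
  have hpos : 0 < ε := hpos
  have hdet : ∀ z : ℂ, (Matrix.scalar ι z - vanW v k * (vanW v k)ᴴ).det
      = ∏ i, (z - (hH.eigenvalues i : ℂ)) := by
    intro z
    rw [← Matrix.eval_charpoly, hH.charpoly_eq, eval_prod]
    simp
  refine ⟨fun i => hH.eigenvalues i - ε, ?_, ?_, ?_, ?_⟩
  · apply Polynomial.funext
    intro z
    rw [Matrix.eval_charpoly, eval_prod]
    have : Matrix.scalar ι z - gramW v k ε
        = Matrix.scalar ι (z + ε) - vanW v k * (vanW v k)ᴴ := by
      ext i j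
      by_cases h : i = j
      · simp [gramW, h]; ring
      · simp [gramW, h]
    rw [this, hdet]
    refine Finset.prod_congr rfl fun i _ => ?_
    simp; ring
  · have : gramW v k ε = -(Matrix.scalar ι (ε : ℂ) - vanW v k * (vanW v k)ᴴ) := by
      simp [gramW]
    rw [this, Matrix.det_neg, hdet, ← Finset.card_univ, ← Finset.prod_const,
      ← Finset.prod_mul_distrib]
    push_cast
    refine Finset.prod_congr rfl fun i _ => ?_
    ring
  · rw [hrank]
    congr 1
    ext i
    simp only [Finset.mem_filter, Finset.mem_univ, true_and, sub_pos]
    exact ⟨fun h => (hpos.trans h).ne', hε i⟩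
  · intro i
    by_cases h : hH.eigenvalues i = 0
    · simp [h, hpos.ne']
    · exact (sub_pos.mpr (hε i h)).ne'

open Polynomial Filter Topology in
theorem gramW_sign {ι : Type} [Fintype ι] [DecidableEq ι] (v : ι → ℂ)
    (hv : Function.Injective v) (k : ℕ) :
    ∀ᶠ ε in 𝓝[>] (0 : ℝ),
      (Fintype.card ι ≤ k → 0 ≤ (gramW v k ε).det) ∧
      (Fintype.card ι = k + 1 → (gramW v k ε).det < 0) := by
  filter_upwards [gramW_core v hv k] with ε hε
  obtain ⟨μ, -, hdet, hcard, hne⟩ := hε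
  rw [hdet]
  constructor
  · intro h
    rw [min_eq_left h, ← Finset.card_univ, Finset.card_filter_eq_iff] at hcard
    exact_mod_cast Finset.prod_nonneg fun i hi => (hcard i hi).le
  · intro h
    rw [h, min_eq_right (Nat.le_succ k)] at hcard
    have hsum := Finset.card_filter_add_card_filter_not (s := (Finset.univ : Finset ι))
      (fun i => 0 < μ i)
    rw [hcard, Finset.card_univ, h] at hsum
    have h1 : (Finset.univ.filter fun i => ¬ 0 < μ i).card = 1 := by omega
    obtain ⟨a, ha⟩ := Finset.card_eq_one.mp h1
    have hprod := Finset.prod_filter_mul_prod_filter_not (Finset.univ : Finset ι)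
      (fun i => 0 < μ i) μ
    rw [ha, Finset.prod_singleton] at hprod
    have haneg : μ a < 0 := by
      have : a ∈ Finset.univ.filter fun i => ¬ 0 < μ i := by rw [ha]; simp
      have := (Finset.mem_filter.mp this).2
      exact lt_of_le_of_ne (not_lt.mp this) (hne a)
    have hp : 0 < ∏ i ∈ Finset.univ.filter (fun i => 0 < μ i), μ i :=
      Finset.prod_pos fun i hi => (Finset.mem_filter.mp hi).2
    have : ∏ i, μ i < 0 := by
      rw [← hprod]
      exact mul_neg_of_pos_of_neg hp haneg
    exact_mod_cast this

open Polynomial in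
theorem count_eigs {n α : Type} [Fintype n] [DecidableEq n] [Fintype α]
    {A : Matrix n n ℂ} (hA : A.IsHermitian) (ν : α → ℝ)
    (h : A.charpoly = ∏ a, (X - C (ν a : ℂ))) (P : ℝ → Prop) [DecidablePred P] :
    (Finset.univ.filter fun i => P (hA.eigenvalues i)).card =
      (Finset.univ.filter fun a => P (ν a)).card := by
  have h1 := hA.roots_charpoly_eq_eigenvalues
  have h2 : A.charpoly.roots = Multiset.map (fun a => (ν a : ℂ)) Finset.univ.val := by
    rw [h, Polynomial.roots_prod]
    · simp
    · simp [Finset.prod_ne_zero_iff, Polynomial.X_sub_C_ne_zero]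
  rw [h2] at h1
  have h3 : Multiset.map ν Finset.univ.val = Multiset.map hA.eigenvalues Finset.univ.val := by
    apply Multiset.map_injective Complex.ofReal_injective
    rw [Multiset.map_map, Multiset.map_map]
    exact h1
  have h4 := congrArg (Multiset.countP P) h3
  rw [Multiset.countP_map, Multiset.countP_map] at h4
  exact h4.symm

theorem block_minor {ι κ : Type} [Fintype ι] [Fintype κ] [DecidableEq ι] [DecidableEq κ] {N : ℕ}
    (e : ι ⊕ κ ≃ Fin N) (B : Matrix ι ι ℂ) (d : κ → ℂ) (S : Finset (Fin N)) :
    (((Matrix.fromBlocks B 0 0 (Matrix.diagonal d)).submatrix e.symm e.symm).submatrix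
      (fun i : S => (i : Fin N)) (fun i : S => (i : Fin N))).det =
    (B.submatrix (fun i : {a // e (Sum.inl a) ∈ S} => (i : ι))
      (fun i : {a // e (Sum.inl a) ∈ S} => (i : ι))).det *
      ∏ b : {b // e (Sum.inr b) ∈ S}, d b := by
  let q : {a // e (Sum.inl a) ∈ S} ⊕ {b // e (Sum.inr b) ∈ S} ≃ S :=
    (Equiv.subtypeSum (p := fun c => e c ∈ S)).symm.trans
      (e.subtypeEquiv (fun c => Iff.rfl))
  rw [← Matrix.det_submatrix_equiv_self q, ← Matrix.det_diagonal,
    ← Matrix.det_fromBlocks_zero₂₁ _ 0]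
  congr 1
  ext i j
  rcases i with i | i <;> rcases j with j | j <;>
    simp [q, Equiv.subtypeSum, Matrix.diagonal_apply, Subtype.ext_iff]

theorem count_sum {ι : Type} [Fintype ι] {a b : ℕ} (μ : ι → ℝ) (P : ℝ → Prop) [DecidablePred P] :
    (Finset.univ.filter fun c => P (Sum.elim μ
      (Sum.elim (fun _ : Fin a => (1 : ℝ)) (fun _ : Fin b => (0 : ℝ))) c)).card =
      (Finset.univ.filter fun c => P (μ c)).card + ((if P 1 then a else 0) +
        (if P 0 then b else 0)) := by
  rw [Finset.card_filter, Finset.card_filter, Fintype.sum_sum_type, Fintype.sum_sum_type]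
  change (∑ c, if P (μ c) then 1 else 0) + ((∑ _c : Fin a, if P 1 then 1 else 0) +
    (∑ _c : Fin b, if P 0 then 1 else 0)) = _
  congr 2 <;> split_ifs <;> simp

open Polynomial Filter Topology in
theorem stmt10_aux {N k : ℕ} (hkN : k < N) (np n0 nm : ℕ)
    (hnp : k ≤ np) (hnm : 1 ≤ nm) (hsum : np + n0 + nm = N) :
    ∃ (A : Matrix (Fin N) (Fin N) ℂ) (hA : A.IsHermitian),
      (Finset.univ.filter fun i => 0 < hA.eigenvalues i).card = np ∧
      (Finset.univ.filter fun i => hA.eigenvalues i = 0).card = n0 ∧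
      (Finset.univ.filter fun i => hA.eigenvalues i < 0).card = nm ∧
      kPMP k A ∧ ¬ kPMP (k + 1) A := by
  classical
  let v : Fin (k + nm) → ℂ := fun i => ((i : ℕ) : ℂ)
  have hv : Function.Injective v := fun i j h => Fin.ext (Nat.cast_injective h)
  have hev : ∀ᶠ ε in 𝓝[>] (0 : ℝ), ∀ p : Fin (k + nm) → Prop,
      (Fintype.card {a // p a} ≤ k →
        0 ≤ (gramW (v ∘ (fun i : {a // p a} => (i : Fin (k + nm)))) k ε).det) ∧
      (Fintype.card {a // p a} = k + 1 →
        (gramW (v ∘ (fun i : {a // p a} => (i : Fin (k + nm)))) k ε).det < 0) := by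
    rw [eventually_all]
    intro p
    exact gramW_sign _ (hv.comp Subtype.val_injective) k
  obtain ⟨ε, hmin, μ, hchar, -, hpos, hne⟩ := (hev.and (gramW_core v hv k)).exists
  have hmin' : ∀ (p : Fin (k + nm) → Prop) [DecidablePred p],
      (Fintype.card {a // p a} ≤ k →
        0 ≤ ((gramW v k ε).submatrix (fun i : {a // p a} => (i : Fin (k + nm)))
          (fun i : {a // p a} => (i : Fin (k + nm)))).det) ∧
      (Fintype.card {a // p a} = k + 1 →
        ((gramW v k ε).submatrix (fun i : {a // p a} => (i : Fin (k + nm)))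
          (fun i : {a // p a} => (i : Fin (k + nm)))).det < 0) := by
    intro p _
    rw [gramW_submatrix _ _ _ _ Subtype.val_injective]
    convert hmin p
  let d : Fin (np - k) ⊕ Fin n0 → ℝ := Sum.elim (fun _ => 1) (fun _ => 0)
  have hd : ∀ b, 0 ≤ d b := by rintro (b | b) <;> simp [d]
  have hcardE : Fintype.card (Fin (k + nm) ⊕ (Fin (np - k) ⊕ Fin n0)) = Fintype.card (Fin N) := by
    simp; omega
  let e := Fintype.equivOfCardEq hcardE
  let A : Matrix (Fin N) (Fin N) ℂ :=
    (Matrix.fromBlocks (gramW v k ε) 0 0 (Matrix.diagonal fun b => (d b : ℂ))).submatrix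
      e.symm e.symm
  have hA : A.IsHermitian := by
    apply Matrix.IsHermitian.submatrix
    refine Matrix.IsHermitian.fromBlocks (gramW_herm v k ε) (by simp) ?_
    rw [Matrix.isHermitian_diagonal_iff]
    intro i
    simp [IsSelfAdjoint]
  have hAc : A.charpoly = ∏ a, (X - C ((Sum.elim μ d a : ℝ) : ℂ)) := by
    have : A = Matrix.reindex e e
      (Matrix.fromBlocks (gramW v k ε) 0 0 (Matrix.diagonal fun b => (d b : ℂ))) := rfl
    rw [this, Matrix.charpoly_reindex, Matrix.charpoly_fromBlocks_zero₁₂, hchar,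
      Matrix.charpoly_diagonal]
    exact (Fintype.prod_sum_type (fun a => X - C ((Sum.elim μ d a : ℝ) : ℂ))).symm
  have hP := count_eigs hA _ hAc
  rw [Fintype.card_fin, min_eq_right (by omega)] at hpos
  have hneg : (Finset.univ.filter fun i => μ i < 0).card = nm := by
    have hs := Finset.card_filter_add_card_filter_not (s := (Finset.univ : Finset (Fin (k + nm))))
      (fun i => 0 < μ i)
    rw [hpos, Finset.card_univ, Fintype.card_fin] at hs
    have : (Finset.univ.filter fun i => μ i < 0) = Finset.univ.filter fun i => ¬ 0 < μ i := by
      ext i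
      simp only [Finset.mem_filter, Finset.mem_univ, true_and, not_lt]
      exact ⟨le_of_lt, fun h => lt_of_le_of_ne h (hne i)⟩
    rw [this]; omega
  have key : ∀ P : ℝ → Prop, ∀ [DecidablePred P],
      (Finset.univ.filter fun a => P (Sum.elim μ d a)).card =
      (Finset.univ.filter fun a => P (μ a)).card + ((if P 1 then np - k else 0) +
        (if P 0 then n0 else 0)) := by
    intro P _
    exact count_sum μ P
  refine ⟨A, hA, ?_, ?_, ?_, ?_, ?_⟩
  · rw [hP (fun x => 0 < x), key (fun x => 0 < x), hpos]
    simp; omega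
  · rw [hP (fun x => x = 0), key (fun x => x = 0)]
    simp [hne]
  · rw [hP (fun x => x < 0), key (fun x => x < 0), hneg]
    have : ¬ ((1 : ℝ) < 0) := by norm_num
    simp [this]
  · intro S hS
    have hb := block_minor e (gramW v k ε) (fun b => (d b : ℂ)) S
    refine le_of_le_of_eq ?_ hb.symm
    refine mul_nonneg ((hmin' _).1 ?_) (Finset.prod_nonneg fun b _ => by exact_mod_cast hd b)
    refine le_trans ?_ hS
    rw [← Fintype.card_coe S]
    exact Fintype.card_le_of_injective
      (fun a : {a // e (Sum.inl a) ∈ S} => (⟨e (Sum.inl a), a.2⟩ : S))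
      (fun a b h => by simpa [Subtype.ext_iff] using h)
  · intro hcon
    obtain ⟨T, -, hT⟩ := Finset.exists_subset_card_eq
      (s := (Finset.univ : Finset (Fin (k + nm)))) (n := k + 1) (by simp; omega)
    let S : Finset (Fin N) := T.map (Function.Embedding.inl.trans e.toEmbedding)
    have h := hcon S (by simp [S, hT])
    have hb := block_minor e (gramW v k ε) (fun b => (d b : ℂ)) S
    replace h := le_of_le_of_eq h hb
    have hemp : IsEmpty {b // e (Sum.inr b) ∈ S} := ⟨fun b => by simpa [S] using b.2⟩
    rw [Fintype.prod_empty, mul_one] at h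
    refine absurd ((hmin' _).2 ?_) (not_lt_of_ge h)
    rw [Fintype.card_subtype, ← hT]
    congr 1
    ext a
    simp [S]

/-- For `0 ≤ k < N` and every signature `(n₊, n₀, n₋)` with `n₊ ≥ k`, `n₋ ≥ 1` and
`n₊ + n₀ + n₋ = N`, there is an `N × N` Hermitian matrix with exactly `n₊`
positive, `n₀` zero and `n₋` negative eigenvalues (with multiplicity) which is
`k`-PMP but not `(k+1)`-PMP. -/
theorem stmt10 {N k : ℕ} (hkN : k < N) (np n0 nm : ℕ)
    (hnp : k ≤ np) (hnm : 1 ≤ nm) (hsum : np + n0 + nm = N) :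
    ∃ (A : Matrix (Fin N) (Fin N) ℂ) (hA : A.IsHermitian),
      (Finset.univ.filter fun i => 0 < hA.eigenvalues i).card = np ∧
      (Finset.univ.filter fun i => hA.eigenvalues i = 0).card = n0 ∧
      (Finset.univ.filter fun i => hA.eigenvalues i < 0).card = nm ∧
      kPMP k A ∧ ¬ kPMP (k + 1) A := by
  exact stmt10_aux hkN np n0 nm hnp hnm hsum
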